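/- (Approximation bound.) Assume 0 < p ≤ P < 1 where p and P are the minimum and maximum entries of E, ε_a > 0 for all a ∈ {1,…,q−1} (with ε_0 = 1), E_0 is injective, and γ < 1 where γ = max_{j} sup_{k} Σ_{a=0}^{q−1} ε_a (Γ_0^k e_j)_a. Let be the matrix A with each infinite series truncated to its first N+1 terms (m = 0,…,N), let Φ̂ = (ÂᵀÂ)⁻¹ Âᵀ b (assuming ÂᵀÂ invertible), and let H_N(μ) = Σ_{j=1}^{q−1} Σ_{m=0}^{N} Σ_{a=0}^{q−1} h_a(Γ_0^m e_j) c_{j,m} Φ̂_j. Then |H(μ) − H_N(μ)| ≤ B γ^{N+1}, where B = (q/(1−γ)) · (1 + q‖Â†‖₁/(1−γ)) with Â† = (ÂᵀÂ)⁻¹Âᵀ and ‖·‖₁ the maximum absolute column sum norm, and H(μ) = lim_{n→∞} S_n/n is the entropy rate of the hidden Markov process. -/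

import Mathlib

open Matrix BigOperators Filter

/-- The normalized posterior update map `Γ_0(ν) = E_0ᵀ ν / ⟨ν, E_0 𝟙⟩`
(defined whenever the denominator is nonzero). -/
noncomputable def gamma0 {q : ℕ} (E0 : Matrix (Fin q) (Fin q) ℝ) (ν : Fin q → ℝ) :
    Fin q → ℝ :=
  fun c => (Matrix.vecMul ν E0) c / (ν ⬝ᵥ (E0 *ᵥ (fun _ => (1 : ℝ))))

/-- Sum over words of length `n` of `f` evaluated at the unnormalized filter. -/
noncomputable def wsum {q : ℕ} {β : Type} [AddCommMonoid β] (M : Fin q → Matrix (Fin q) (Fin q) ℝ)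
    (τ : Fin q → ℝ) (n : ℕ) (f : (Fin q → ℝ) → β) : β :=
  ∑ w : Fin n → Fin q, f (τ ᵥ* (List.ofFn (fun i => M (w i))).prod)

lemma wsum_succ {q : ℕ} {β : Type} [AddCommMonoid β] (M : Fin q → Matrix (Fin q) (Fin q) ℝ)
    (τ : Fin q → ℝ) (n : ℕ) (f : (Fin q → ℝ) → β) :
    wsum M τ (n+1) f = wsum M τ n (fun v => ∑ a, f (v ᵥ* M a)) := by
  unfold wsum
  rw [← (Fin.snocEquiv (fun _ => Fin q)).sum_comp, Fintype.sum_prod_type, Finset.sum_comm]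
  refine Finset.sum_congr rfl fun w _ => Finset.sum_congr rfl fun a _ => ?_
  congr 1
  rw [List.ofFn_succ', List.concat_eq_append, List.prod_append]
  simp [Fin.snocEquiv, Matrix.vecMul_vecMul]

lemma wsum_zero {q : ℕ} {β : Type} [AddCommMonoid β] (M : Fin q → Matrix (Fin q) (Fin q) ℝ)
    (τ : Fin q → ℝ) (f : (Fin q → ℝ) → β) : wsum M τ 0 f = f τ := by
  simp [wsum]

lemma wsum_id {q : ℕ} (M : Fin q → Matrix (Fin q) (Fin q) ℝ) (E : Matrix (Fin q) (Fin q) ℝ)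
    (hM : ∑ a, M a = E) (τ : Fin q → ℝ) (hτ : τ ᵥ* E = τ) (n : ℕ) :
    wsum M τ n (fun v => v) = τ := by
  induction n with
  | zero => simp [wsum_zero]
  | succ n ih =>
    rw [wsum_succ]
    have : (fun v : Fin q → ℝ => ∑ a, v ᵥ* M a) = fun v => v ᵥ* E := by
      funext v
      rw [← hM, Matrix.vecMul_sum]
    rw [this]
    unfold wsum at ih ⊢
    rw [← Matrix.sum_vecMul, ih, hτ]

lemma vecMul_nonneg' {q : ℕ} (M : Matrix (Fin q) (Fin q) ℝ) (hM : ∀ i j, 0 ≤ M i j)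
    (v : Fin q → ℝ) (hv : ∀ i, 0 ≤ v i) : ∀ i, 0 ≤ (v ᵥ* M) i := by
  intro i
  simp only [vecMul, dotProduct]
  exact Finset.sum_nonneg fun j _ => mul_nonneg (hv j) (hM j i)

lemma vecMul_list_nonneg {q : ℕ} (l : List (Matrix (Fin q) (Fin q) ℝ))
    (hl : ∀ M ∈ l, ∀ i j, 0 ≤ M i j)
    (v : Fin q → ℝ) (hv : ∀ i, 0 ≤ v i) : ∀ i, 0 ≤ (v ᵥ* l.prod) i := by
  induction l generalizing v with
  | nil => simpa using hv
  | cons M l ih =>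
    rw [List.prod_cons, ← Matrix.vecMul_vecMul]
    exact ih (fun M' h => hl M' (by simp [h])) _ (vecMul_nonneg' M (hl M (by simp)) v hv)

lemma vecMul_pow_nonneg {q : ℕ} (M : Matrix (Fin q) (Fin q) ℝ) (hM : ∀ i j, 0 ≤ M i j)
    (v : Fin q → ℝ) (hv : ∀ i, 0 ≤ v i) (n : ℕ) : ∀ i, 0 ≤ (v ᵥ* M ^ n) i := by
  have := vecMul_list_nonneg (List.replicate n M)
    (fun M' h => by rw [(List.mem_replicate.1 h).2]; exact hM) v hv
  simpa using this

/-- Decomposition of word sums by the position of the last nonzero symbol. -/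
lemma wsum_decomp {q : ℕ} [NeZero q] (M : Fin q → Matrix (Fin q) (Fin q) ℝ)
    (E : Matrix (Fin q) (Fin q) ℝ) (eps : Fin q → ℝ)
    (hM : ∑ a, M a = E) (hMnn : ∀ a i j, 0 ≤ M a i j) (hEnn : ∀ i j, 0 ≤ E i j)
    (heps : ∀ a : Fin q, a ≠ 0 → 0 < eps a ∧ eps a < 1)
    (hMa : ∀ a : Fin q, a ≠ 0 → ∀ v : Fin q → ℝ, v ᵥ* M a = ((1 - eps a) * v a) • E a)
    (τ : Fin q → ℝ) (hτnn : ∀ i, 0 ≤ τ i) (hτ : τ ᵥ* E = τ) (n : ℕ)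
    (f : (Fin q → ℝ) → ℝ)
    (hf : ∀ (s : ℝ) (v : Fin q → ℝ), 0 ≤ s → (∀ i, 0 ≤ v i) → f (s • v) = s * f v) :
    wsum M τ n f = ∑ m ∈ Finset.range n, ∑ a : {j : Fin q // j ≠ 0},
        (τ a.val * (1 - eps a.val)) * f (E a.val ᵥ* (M 0)^m) + f (τ ᵥ* (M 0)^n) := by
  induction n generalizing f with
  | zero => simp [wsum_zero]
  | succ n ih =>
    have key : wsum M τ (n+1) f = wsum M τ n (fun v => f (v ᵥ* M 0)) +
        ∑ a : {j : Fin q // j ≠ 0}, (τ a.val * (1 - eps a.val)) * f (E a.val) := by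
      rw [wsum_succ]
      have hsplit : ∀ v : Fin q → ℝ, ∑ a, f (v ᵥ* M a) =
          f (v ᵥ* M 0) + ∑ a : {j : Fin q // j ≠ 0}, f (v ᵥ* M a.val) := fun v =>
        Fintype.sum_eq_add_sum_subtype_ne (fun a => f (v ᵥ* M a)) 0
      simp only [hsplit]
      unfold wsum
      rw [Finset.sum_add_distrib, Finset.sum_comm (s := Finset.univ (α := Fin n → Fin q))]
      congr 1
      refine Finset.sum_congr rfl fun a _ => ?_
      have hid := wsum_id M E hM τ hτ n
      unfold wsum at hid
      have hid' := congrFun hid a.val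
      rw [Finset.sum_apply] at hid'
      conv_rhs => rw [← hid', Finset.sum_mul, Finset.sum_mul]
      refine Finset.sum_congr rfl fun w _ => ?_
      rw [hMa a.val a.2, hf _ _ _ (hEnn a.val)]
      · ring
      · refine mul_nonneg (by linarith [(heps a.val a.2).2]) ?_
        refine vecMul_list_nonneg _ ?_ τ hτnn _
        intro M' h'
        rw [List.mem_ofFn] at h'
        obtain ⟨i, rfl⟩ := h'
        exact hMnn _
    rw [key, ih]
    · rw [Finset.sum_range_succ' _ n]
      simp only [Matrix.vecMul_vecMul, ← pow_succ]
      simp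
      ring
    · intro s v hs hv
      rw [Matrix.smul_vecMul, hf _ _ hs (vecMul_nonneg' _ (hMnn 0) v hv)]

lemma gamma0_iter {q : ℕ} (E : Matrix (Fin q) (Fin q) ℝ) (eps : Fin q → ℝ)
    (hE_pos : ∀ i j, 0 < E i j) (heps : ∀ a, 0 < eps a)
    (M : Matrix (Fin q) (Fin q) ℝ) (hM : ∀ b c, M b c = eps b * E b c)
    (hM1 : M *ᵥ (fun _ => (1 : ℝ)) = eps)
    (ν : Fin q → ℝ) (hν : ∀ i, 0 ≤ ν i) (hν1 : ∑ i, ν i = 1) (m : ℕ) :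
    (∀ i, 0 ≤ ((gamma0 M)^[m] ν) i) ∧ ∑ i, ((gamma0 M)^[m] ν) i = 1 ∧
    0 < ((gamma0 M)^[m] ν) ⬝ᵥ eps ∧
    ν ᵥ* M ^ m = (∏ i ∈ Finset.range m, ((gamma0 M)^[i] ν) ⬝ᵥ eps) • ((gamma0 M)^[m] ν) := by
  have hpos : ∀ v : Fin q → ℝ, (∀ i, 0 ≤ v i) → ∑ i, v i = 1 → 0 < v ⬝ᵥ eps := by
    intro v hv h1
    have hex : ∃ i, 0 < v i := by
      by_contra hcon
      push Not at hcon
      have : ∑ i, v i ≤ 0 := Finset.sum_nonpos fun i _ => hcon i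
      linarith
    obtain ⟨i, hi⟩ := hex
    exact Finset.sum_pos' (fun j _ => mul_nonneg (hv j) (heps j).le)
      ⟨i, Finset.mem_univ _, mul_pos hi (heps i)⟩
  induction m with
  | zero => simpa using ⟨hν, hν1, hpos ν hν hν1⟩
  | succ m ih =>
    obtain ⟨h1, h2, h3, h4⟩ := ih
    set G := (gamma0 M)^[m] ν with hG
    have hstep : (gamma0 M)^[m+1] ν = gamma0 M G := Function.iterate_succ_apply' _ _ _
    have hMnn : ∀ i j, 0 ≤ M i j := fun i j => by
      rw [hM]; exact mul_nonneg (heps i).le (hE_pos i j).le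
    have hg : ∀ i, (gamma0 M G) i = (G ᵥ* M) i / (G ⬝ᵥ eps) := fun i => by
      rw [gamma0, hM1]
    have hnn : ∀ i, 0 ≤ (gamma0 M G) i := fun i => by
      rw [hg]
      exact div_nonneg (vecMul_nonneg' M hMnn G h1 i) h3.le
    have hsum : ∑ i, (gamma0 M G) i = 1 := by
      simp only [hg]
      rw [← Finset.sum_div, div_eq_one_iff_eq h3.ne', ← hM1, Matrix.dotProduct_mulVec]
      simp [dotProduct]
    rw [hstep]
    refine ⟨hnn, hsum, hpos _ hnn hsum, ?_⟩
    rw [pow_succ, ← Matrix.vecMul_vecMul, h4, Matrix.smul_vecMul, Finset.prod_range_succ, mul_smul]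
    congr 1
    funext i
    rw [Pi.smul_apply, hg, smul_eq_mul, mul_div_cancel₀ _ h3.ne']

noncomputable def lfun {q : ℕ} (M : Fin q → Matrix (Fin q) (Fin q) ℝ) (v : Fin q → ℝ) : ℝ :=
  (∑ a, Real.negMulLog (v ⬝ᵥ (M a *ᵥ (fun _ => (1 : ℝ))))) -
    Real.negMulLog (v ⬝ᵥ (fun _ => (1 : ℝ)))

lemma sum_mulVec_one {q : ℕ} (M : Fin q → Matrix (Fin q) (Fin q) ℝ) (E : Matrix (Fin q) (Fin q) ℝ)
    (hM : ∑ a, M a = E) (hE_rows : ∀ i, ∑ j, E i j = 1) (v : Fin q → ℝ) :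
    ∑ a, v ⬝ᵥ (M a *ᵥ (fun _ => (1 : ℝ))) = v ⬝ᵥ (fun _ => (1 : ℝ)) := by
  rw [← dotProduct_sum, ← Matrix.sum_mulVec, hM]
  congr 1
  funext i
  simp [mulVec, dotProduct, hE_rows]

lemma lfun_hom {q : ℕ} (M : Fin q → Matrix (Fin q) (Fin q) ℝ) (E : Matrix (Fin q) (Fin q) ℝ)
    (hM : ∑ a, M a = E) (hE_rows : ∀ i, ∑ j, E i j = 1) (s : ℝ) (v : Fin q → ℝ) :
    lfun M (s • v) = s * lfun M v := by
  unfold lfun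
  simp only [smul_dotProduct, smul_eq_mul, Real.negMulLog_mul, Finset.sum_add_distrib]
  rw [← Finset.sum_mul, ← Finset.mul_sum, sum_mulVec_one M E hM hE_rows]
  ring

lemma negMulLog_bound {x : ℝ} (h0 : 0 ≤ x) : Real.negMulLog x ≤ 1 := by
  have := Real.negMulLog_le_one_sub_self h0
  linarith

lemma dot_nonneg {q : ℕ} (M : Matrix (Fin q) (Fin q) ℝ) (hM : ∀ i j, 0 ≤ M i j)
    (v : Fin q → ℝ) (hv : ∀ i, 0 ≤ v i) : 0 ≤ v ⬝ᵥ (M *ᵥ (fun _ => (1 : ℝ))) :=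
  Finset.sum_nonneg fun i _ => mul_nonneg (hv i) (by
    simp only [mulVec, dotProduct, mul_one]
    exact Finset.sum_nonneg fun j _ => hM i j)

lemma lfun_prob {q : ℕ} (M : Fin q → Matrix (Fin q) (Fin q) ℝ) (E : Matrix (Fin q) (Fin q) ℝ)
    (hM : ∑ a, M a = E) (hMnn : ∀ a i j, 0 ≤ M a i j) (hE_rows : ∀ i, ∑ j, E i j = 1)
    (v : Fin q → ℝ) (hv : ∀ i, 0 ≤ v i) (hv1 : ∑ i, v i = 1) :
    lfun M v = ∑ a, Real.negMulLog (v ⬝ᵥ (M a *ᵥ (fun _ => (1 : ℝ)))) ∧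
    0 ≤ lfun M v ∧ lfun M v ≤ q := by
  have h1 : v ⬝ᵥ (fun _ => (1 : ℝ)) = 1 := by simpa [dotProduct] using hv1
  have heq : lfun M v = ∑ a, Real.negMulLog (v ⬝ᵥ (M a *ᵥ (fun _ => (1 : ℝ)))) := by
    simp [lfun, h1]
  have hnn : ∀ a, 0 ≤ v ⬝ᵥ (M a *ᵥ (fun _ => (1 : ℝ))) := fun a =>
    dot_nonneg (M a) (hMnn a) v hv
  have hle : ∀ a, v ⬝ᵥ (M a *ᵥ (fun _ => (1 : ℝ))) ≤ 1 := fun a => by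
    refine le_trans ?_ ((sum_mulVec_one M E hM hE_rows v).trans h1).le
    exact Finset.single_le_sum (f := fun a => v ⬝ᵥ (M a *ᵥ (fun _ => (1 : ℝ))))
      (fun a _ => hnn a) (Finset.mem_univ a)
  refine ⟨heq, ?_, ?_⟩
  · rw [heq]
    exact Finset.sum_nonneg fun a _ => Real.negMulLog_nonneg (hnn a) (hle a)
  · rw [heq]
    calc _ ≤ ∑ a : Fin q, (1 : ℝ) := Finset.sum_le_sum fun a _ => negMulLog_bound (hnn a)
      _ = q := by simp

lemma lfun_bound {q : ℕ} (M : Fin q → Matrix (Fin q) (Fin q) ℝ) (E : Matrix (Fin q) (Fin q) ℝ)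
    (hM : ∑ a, M a = E) (hMnn : ∀ a i j, 0 ≤ M a i j) (hE_rows : ∀ i, ∑ j, E i j = 1)
    (v : Fin q → ℝ) (hv : ∀ i, 0 ≤ v i) :
    |lfun M v| ≤ q * (v ⬝ᵥ (fun _ => (1 : ℝ))) := by
  set s := v ⬝ᵥ (fun _ => (1 : ℝ)) with hs
  have hs' : s = ∑ i, v i := by simp [hs, dotProduct]
  have hs0 : 0 ≤ s := hs' ▸ Finset.sum_nonneg fun i _ => hv i
  rcases hs0.eq_or_lt with h0 | h0
  · have : v = (0 : ℝ) • v := by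
      funext i
      have := (Finset.sum_eq_zero_iff_of_nonneg (fun i _ => hv i)).1 (hs'.symm.trans h0.symm) i
        (Finset.mem_univ i)
      simpa using this
    rw [this, lfun_hom M E hM hE_rows, ← h0]
    simp
  · have hv' : v = s • (s⁻¹ • v) := by rw [smul_smul, mul_inv_cancel₀ h0.ne', one_smul]
    obtain ⟨-, h1, h2⟩ := lfun_prob M E hM hMnn hE_rows (s⁻¹ • v)
      (fun i => mul_nonneg (inv_nonneg.2 hs0) (hv i))
      (by simp only [Pi.smul_apply, smul_eq_mul]
          rw [← Finset.mul_sum, ← hs', inv_mul_cancel₀ h0.ne'])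
    rw [hv', lfun_hom M E hM hE_rows, abs_mul, abs_of_pos h0, abs_of_nonneg h1, mul_comm]
    exact mul_le_mul_of_nonneg_right h2 hs0

/-- Survival probability of the all-zero word tends to zero. -/
lemma tail_tendsto {q : ℕ} [NeZero q] (hq : 2 ≤ q) (E : Matrix (Fin q) (Fin q) ℝ) (eps : Fin q → ℝ)
    (hE_pos : ∀ i j, 0 < E i j) (hE_rows : ∀ i, ∑ j, E i j = 1) (heps : ∀ a, 0 < eps a)
    (heps1 : ∀ a, eps a ≤ 1) (heps' : ∀ a, a ≠ 0 → eps a < 1)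
    (M : Matrix (Fin q) (Fin q) ℝ) (hM : ∀ b c, M b c = eps b * E b c)
    (hM1 : M *ᵥ (fun _ => (1 : ℝ)) = eps)
    (τ : Fin q → ℝ) (hτ : ∀ i, 0 ≤ τ i) :
    Tendsto (fun n : ℕ => (τ ᵥ* M ^ n) ⬝ᵥ (fun _ => (1 : ℝ))) atTop (nhds 0) := by
  set t := fun n : ℕ => (τ ᵥ* M ^ n) ⬝ᵥ (fun _ => (1 : ℝ)) with ht
  have hMnn : ∀ i j, 0 ≤ M i j := fun i j => by
    rw [hM]; exact mul_nonneg (heps i).le (hE_pos i j).le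
  have hnn := vecMul_pow_nonneg M hMnn τ hτ
  have hstep : ∀ n, t (n+1) = (τ ᵥ* M ^ n) ⬝ᵥ eps := fun n => by
    simp only [ht]
    rw [pow_succ, ← Matrix.vecMul_vecMul, ← Matrix.dotProduct_mulVec, hM1]
  have hstep2 : ∀ n, t (n+2) = (τ ᵥ* M ^ n) ⬝ᵥ (M *ᵥ eps) := fun n => by
    rw [hstep, pow_succ, ← Matrix.vecMul_vecMul, ← Matrix.dotProduct_mulVec]
  have ht0 : ∀ n, 0 ≤ t n := fun n => by
    simp only [ht, dotProduct, mul_one]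
    exact Finset.sum_nonneg fun i _ => hnn n i
  have hanti : Antitone t := antitone_nat_of_succ_le fun n => by
    rw [hstep]
    exact Finset.sum_le_sum fun i _ => mul_le_mul_of_nonneg_left (heps1 i) (hnn n i)
  have hlt : ∀ a, (M *ᵥ eps) a < 1 := fun a => by
    have h1 : (M *ᵥ eps) a = eps a * ∑ b, E a b * eps b := by
      simp only [mulVec, dotProduct, hM]
      rw [Finset.mul_sum]
      exact Finset.sum_congr rfl fun b _ => by ring
    have h2 : ∑ b, E a b * eps b < 1 := by
      rw [← hE_rows a]
      refine Finset.sum_lt_sum (fun b _ => by nlinarith [hE_pos a b, heps1 b])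
        ⟨⟨1, by omega⟩, Finset.mem_univ _, ?_⟩
      have hne : (⟨1, by omega⟩ : Fin q) ≠ 0 := by
        intro h
        have := congrArg Fin.val h
        simp at this
      nlinarith [hE_pos a ⟨1, by omega⟩, heps' _ hne]
    have h3 : 0 ≤ ∑ b, E a b * eps b :=
      Finset.sum_nonneg fun b _ => mul_nonneg (hE_pos a b).le (heps b).le
    rw [h1]
    nlinarith [heps1 a, heps a]
  obtain ⟨a0, ha0⟩ := Finite.exists_max (fun a => (M *ᵥ eps) a)
  set ρ := (M *ᵥ eps) a0
  have hρ : ρ < 1 := hlt a0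
  have hcontr : ∀ n, t (n+2) ≤ ρ * t n := fun n => by
    rw [hstep2]
    simp only [ht, dotProduct, mul_one]
    rw [Finset.mul_sum]
    refine Finset.sum_le_sum fun i _ => ?_
    rw [mul_comm ρ]
    exact mul_le_mul_of_nonneg_left (ha0 i) (hnn n i)
  have hbdd : BddBelow (Set.range t) := ⟨0, by rintro _ ⟨n, rfl⟩; exact ht0 n⟩
  have hlim := tendsto_atTop_ciInf hanti hbdd
  have hl0 : 0 ≤ ⨅ n, t n := le_ciInf ht0
  have hl1 : (⨅ n, t n) ≤ ρ * ⨅ n, t n :=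
    le_of_tendsto_of_tendsto' ((tendsto_add_atTop_iff_nat 2).2 hlim) (hlim.const_mul ρ) hcontr
  have : (⨅ n, t n) = 0 := by nlinarith
  rwa [this] at hlim

lemma adag_bound {I J : Type} [Fintype I] [Fintype J] (X : Matrix J I ℝ) (d : I → ℝ) :
    ∑ j, |(X *ᵥ d) j| ≤ (⨆ col, ∑ row, |X row col|) * ∑ i, |d i| := by
  calc ∑ j, |(X *ᵥ d) j| ≤ ∑ j, ∑ i, |X j i| * |d i| := by
        refine Finset.sum_le_sum fun j _ => ?_
        simp only [mulVec, dotProduct]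
        refine (Finset.abs_sum_le_sum_abs _ _).trans (le_of_eq ?_)
        simp only [abs_mul]
    _ = ∑ i, (∑ j, |X j i|) * |d i| := by
        rw [Finset.sum_comm]
        simp only [Finset.sum_mul]
    _ ≤ ∑ i, (⨆ col, ∑ row, |X row col|) * |d i| := by
        refine Finset.sum_le_sum fun i _ => mul_le_mul_of_nonneg_right ?_ (abs_nonneg _)
        exact le_ciSup (f := fun i => ∑ row, |X row i|) (Set.finite_range _).bddAbove i
    _ = _ := by rw [Finset.mul_sum]

lemma numeric_bound {J : Type} [Fintype J] [DecidableEq J] (Q γ : ℝ) (hQ : 2 ≤ Q)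
    (hγ0 : 0 ≤ γ) (hγ1 : γ < 1) (Φ : J → ℝ) (c g : J → ℕ → ℝ) (t r D S : ℕ → ℝ)
    (hΦ0 : ∀ j, 0 ≤ Φ j) (hΦ1 : ∑ j, Φ j ≤ 1)
    (hc0 : ∀ j m, 0 ≤ c j m) (hc1 : ∀ j m, c j m ≤ γ ^ m)
    (hg0 : ∀ j m, 0 ≤ g j m) (hg1 : ∀ j m, g j m ≤ Q)
    (h1 : ∀ n, 1 = ∑ m ∈ Finset.range n, ∑ j, Φ j * c j m + t n)
    (ht : Tendsto t atTop (nhds 0))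
    (hD : ∀ n, D n = ∑ m ∈ Finset.range n, ∑ j, Φ j * (c j m * g j m) + r n)
    (hr : ∀ n, |r n| ≤ Q * t n) (hS : ∀ n, S n = ∑ i ∈ Finset.range n, D i)
    (N : ℕ) (A : Matrix (J ⊕ Unit) J ℝ) (X : Matrix J (J ⊕ Unit) ℝ) (hXA : X * A = 1)
    (b : J ⊕ Unit → ℝ) (hb : ∑ i, |(A *ᵥ Φ - b) i| ≤ 2 * t (N+1))
    (Φh : J → ℝ) (hΦh : Φh = X *ᵥ b) (HN : ℝ)
    (hHN : HN = ∑ j, (∑ m ∈ Finset.range (N + 1), c j m * g j m) * Φh j)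
    (H : ℝ) (hH : Tendsto (fun n : ℕ => S n / n) atTop (nhds H)) :
    |H - HN| ≤ ((Q / (1 - γ)) * (1 + Q * (⨆ col, ∑ row, |X row col|) / (1 - γ))) * γ ^ (N+1) := by
  have hγ' : 0 < 1 - γ := by linarith
  set K := ⨆ col, ∑ row, |X row col| with hK
  have hK0 : 0 ≤ K := Real.iSup_nonneg fun i => Finset.sum_nonneg fun j _ => abs_nonneg _
  -- averages against Φ
  have havg : ∀ (x : J → ℝ) (y : ℝ), 0 ≤ y → (∀ j, x j ≤ y) → ∑ j, Φ j * x j ≤ y := by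
    intro x y hy hx
    calc ∑ j, Φ j * x j ≤ ∑ j, Φ j * y :=
          Finset.sum_le_sum fun j _ => mul_le_mul_of_nonneg_left (hx j) (hΦ0 j)
      _ = (∑ j, Φ j) * y := by rw [Finset.sum_mul]
      _ ≤ 1 * y := mul_le_mul_of_nonneg_right hΦ1 hy
      _ = y := one_mul y
  -- tail bound
  have htail : t (N+1) ≤ γ ^ (N+1) / (1 - γ) := by
    have hev : ∀ᶠ n in atTop, t (N+1) ≤ γ ^ (N+1) / (1 - γ) + t n := by
      filter_upwards [eventually_ge_atTop (N+1)] with n hn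
      have e1 := h1 (N+1)
      have e2 := h1 n
      rw [← Finset.sum_range_add_sum_Ico _ hn] at e2
      have e3 : ∑ m ∈ Finset.Ico (N+1) n, ∑ j, Φ j * c j m ≤ γ ^ (N+1) / (1 - γ) := by
        refine le_trans (Finset.sum_le_sum fun m _ => ?_) (geom_sum_Ico_le_of_lt_one hγ0 hγ1)
        exact havg _ _ (pow_nonneg hγ0 m) fun j => hc1 j m
      linarith
    have := ge_of_tendsto (ht.const_add (γ ^ (N+1) / (1 - γ))) hev
    simpa using this
  set s : ℕ → ℝ := fun m => ∑ j, Φ j * (c j m * g j m) with hs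
  have hcg : ∀ j m, c j m * g j m ≤ Q * γ ^ m := fun j m => by
    rw [mul_comm Q]
    exact mul_le_mul (hc1 j m) (hg1 j m) (hg0 j m) (pow_nonneg hγ0 m)
  have hs0 : ∀ m, 0 ≤ s m := fun m => Finset.sum_nonneg fun j _ =>
    mul_nonneg (hΦ0 j) (mul_nonneg (hc0 j m) (hg0 j m))
  have hs1 : ∀ m, s m ≤ Q * γ ^ m := fun m =>
    havg _ _ (mul_nonneg (by linarith) (pow_nonneg hγ0 m)) fun j => hcg j m
  have hsum : Summable s := Summable.of_nonneg_of_le hs0 hs1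
    ((summable_geometric_of_lt_one hγ0 hγ1).mul_left Q)
  have hr0 : Tendsto r atTop (nhds 0) := by
    apply squeeze_zero_norm (a := fun n => Q * t n) (fun n => hr n)
    simpa using ht.const_mul Q
  have hDlim : Tendsto D atTop (nhds (∑' m, s m)) := by
    have := hsum.hasSum.tendsto_sum_nat.add hr0
    rw [add_zero] at this
    refine this.congr fun n => (hD n).symm
  have hHeq : H = ∑' m, s m := by
    refine tendsto_nhds_unique hH ?_
    refine hDlim.cesaro.congr fun n => ?_
    rw [hS, div_eq_inv_mul]
  have hlo : |H - ∑ m ∈ Finset.range (N+1), s m| ≤ Q * (γ ^ (N+1) / (1 - γ)) := by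
    rw [hHeq]
    refine le_of_tendsto ((hsum.hasSum.tendsto_sum_nat.sub_const _).abs) ?_
    filter_upwards [eventually_ge_atTop (N+1)] with n hn
    rw [← Finset.sum_range_add_sum_Ico _ hn, add_sub_cancel_left,
      abs_of_nonneg (Finset.sum_nonneg fun m _ => hs0 m)]
    calc _ ≤ ∑ m ∈ Finset.Ico (N+1) n, Q * γ ^ m := Finset.sum_le_sum fun m _ => hs1 m
      _ = Q * ∑ m ∈ Finset.Ico (N+1) n, γ ^ m := by rw [Finset.mul_sum]
      _ ≤ _ := mul_le_mul_of_nonneg_left (geom_sum_Ico_le_of_lt_one hγ0 hγ1) (by linarith)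
  have hdiff : Φ - Φh = X *ᵥ (A *ᵥ Φ - b) := by
    rw [Matrix.mulVec_sub, Matrix.mulVec_mulVec, hXA, Matrix.one_mulVec, hΦh]
  have hΦd : ∑ j, |Φ j - Φh j| ≤ K * (2 * (γ ^ (N+1) / (1 - γ))) := by
    have := adag_bound X (A *ᵥ Φ - b)
    rw [← hdiff] at this
    refine this.trans (mul_le_mul_of_nonneg_left (hb.trans ?_) hK0)
    linarith
  have hhi : |∑ m ∈ Finset.range (N+1), s m - HN| ≤
      Q / (1 - γ) * (K * (2 * (γ ^ (N+1) / (1 - γ)))) := by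
    have e : ∑ m ∈ Finset.range (N+1), s m - HN =
        ∑ j, (∑ m ∈ Finset.range (N + 1), c j m * g j m) * (Φ j - Φh j) := by
      simp only [hs, mul_sub, Finset.sum_sub_distrib]
      rw [hHN, Finset.sum_comm]
      congr 1
      refine Finset.sum_congr rfl fun j _ => ?_
      rw [← Finset.mul_sum, mul_comm]
    rw [e]
    calc _ ≤ ∑ j, Q / (1 - γ) * |Φ j - Φh j| := by
          refine (Finset.abs_sum_le_sum_abs _ _).trans (Finset.sum_le_sum fun j _ => ?_)
          rw [abs_mul]
          refine mul_le_mul_of_nonneg_right ?_ (abs_nonneg _)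
          rw [abs_of_nonneg (Finset.sum_nonneg fun m _ => mul_nonneg (hc0 j m) (hg0 j m))]
          calc _ ≤ ∑ m ∈ Finset.range (N+1), Q * γ ^ m := Finset.sum_le_sum fun m _ => hcg j m
            _ = Q * ∑ m ∈ Finset.Ico 0 (N+1), γ ^ m := by
                rw [Finset.mul_sum, Finset.range_eq_Ico]
            _ ≤ Q * (γ ^ 0 / (1 - γ)) :=
                mul_le_mul_of_nonneg_left (geom_sum_Ico_le_of_lt_one hγ0 hγ1) (by linarith)
            _ = _ := by rw [pow_zero, mul_one_div]
      _ = Q / (1 - γ) * ∑ j, |Φ j - Φh j| := by rw [Finset.mul_sum]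
      _ ≤ _ := mul_le_mul_of_nonneg_left hΦd (by positivity)
  have hG : 0 ≤ Q / (1 - γ) * (K * (γ ^ (N+1) / (1 - γ))) := by positivity
  calc |H - HN| ≤ |H - ∑ m ∈ Finset.range (N+1), s m| + |∑ m ∈ Finset.range (N+1), s m - HN| :=
        abs_sub_le _ _ _
    _ ≤ Q * (γ ^ (N+1) / (1 - γ)) + Q / (1 - γ) * (K * (2 * (γ ^ (N+1) / (1 - γ)))) :=
        add_le_add hlo hhi
    _ = Q * (γ ^ (N+1) / (1 - γ)) + 2 * (Q / (1 - γ) * (K * (γ ^ (N+1) / (1 - γ)))) := by ring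
    _ ≤ Q * (γ ^ (N+1) / (1 - γ)) + Q * (Q / (1 - γ) * (K * (γ ^ (N+1) / (1 - γ)))) := by
        have := mul_le_mul_of_nonneg_right hQ hG
        linarith
    _ = _ := by ring

/-- **Approximation bound.** Under Assumption 1 (entries of `E` strictly
between `0` and `1`, `ε_a ∈ (0,1)` with `ε_0 = 1`, `E_0` injective) and `γ < 1`, where
`γ = max_j sup_k Σ_a ε_a (Γ_0^k e_j)_a`, let `Â` be the matrix `A` with each infinite
series truncated to its first `N+1` terms; `Â` is indexed with rows
`{1,…,q-1} ⊕ {normalization row}` and columns `{1,…,q-1}`, and `b = (0,…,0,1)ᵀ`.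
Let `Â† = (ÂᵀÂ)⁻¹Âᵀ` (assuming `ÂᵀÂ` invertible), `Φ̂ = Â† b`, and
`H_N(μ) = Σ_{j=1}^{q-1} Σ_{m=0}^{N} Σ_{a=0}^{q-1} h_a(Γ_0^m e_j) c_{j,m} Φ̂_j`.
Then `|H(μ) - H_N(μ)| ≤ B γ^{N+1}` with
`B = (q/(1-γ))(1 + q‖Â†‖₁/(1-γ))`, `‖·‖₁` being the maximum absolute column sum, and
`H(μ) = lim_n S_n / n` the entropy rate of the hidden Markov process. -/
theorem entropy_rate_approximation_bound
    (q : ℕ) [NeZero q] (hq : 2 ≤ q)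
    (E : Matrix (Fin q) (Fin q) ℝ)
    (hE_pos : ∀ i j, 0 < E i j)
    (hE_lt_one : ∀ i j, E i j < 1)
    (hE_rows : ∀ i, ∑ j, E i j = 1)
    (τ : Fin q → ℝ)
    (hτ_nonneg : ∀ i, 0 ≤ τ i)
    (hτ_sum : ∑ i, τ i = 1)
    (hτ_stat : Matrix.vecMul τ E = τ)
    (F : Fin q → Matrix (Fin q) (Fin q) ℝ)
    (hF : ∀ a b c, F a b c = if a = b then E a c else 0)
    (eps : Fin q → ℝ)
    (heps0 : eps 0 = 1)
    (heps : ∀ a : Fin q, a ≠ 0 → 0 < eps a ∧ eps a < 1)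
    (EE : Fin q → Matrix (Fin q) (Fin q) ℝ)
    (hEE0 : EE 0 = F 0 + ∑ a ∈ Finset.univ.erase 0, eps a • F a)
    (hEEa : ∀ a : Fin q, a ≠ 0 → EE a = (1 - eps a) • F a)
    (hinj : Function.Injective fun v : Fin q → ℝ => (EE 0) *ᵥ v)
    (c : Fin q → ℕ → ℝ)
    (hc : ∀ j m, c j m = ∏ i ∈ Finset.Icc 1 m,
        ((gamma0 (EE 0))^[m - i] (E j)) ⬝ᵥ ((EE 0) *ᵥ (fun _ => (1 : ℝ))))
    (h : Fin q → (Fin q → ℝ) → ℝ)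
    (hh : ∀ a ν, h a ν = -(ν ⬝ᵥ ((EE a) *ᵥ (fun _ => (1 : ℝ)))) *
        Real.log (ν ⬝ᵥ ((EE a) *ᵥ (fun _ => (1 : ℝ)))))
    (γ : ℝ)
    (hγ : γ = ⨆ j : {j : Fin q // j ≠ 0}, ⨆ k : ℕ,
            ∑ a : Fin q, eps a * ((gamma0 (EE 0))^[k] (E j.val)) a)
    (hγ_lt_one : γ < 1)
    (N : ℕ)
    (Ahat : Matrix ({j : Fin q // j ≠ 0} ⊕ Unit) {j : Fin q // j ≠ 0} ℝ)
    (hAhat_symbol : ∀ (i j : {j : Fin q // j ≠ 0}),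
        Ahat (Sum.inl i) j =
          if q = 2 then 0 else
            ((if i = j then (-1 : ℝ) else 0) +
              ∑ m ∈ Finset.range (N + 1),
                (((gamma0 (EE 0))^[m] (E j.val)) ⬝ᵥ ((EE i.val) *ᵥ (fun _ => (1 : ℝ)))) *
                  c j.val m))
    (hAhat_last : ∀ j : {j : Fin q // j ≠ 0},
        Ahat (Sum.inr ()) j = ∑ m ∈ Finset.range (N + 1), c j.val m)
    (hAhat_unit : IsUnit (Ahatᵀ * Ahat).det)
    (Adag : Matrix {j : Fin q // j ≠ 0} ({j : Fin q // j ≠ 0} ⊕ Unit) ℝ)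
    (hAdag : Adag = (Ahatᵀ * Ahat)⁻¹ * Ahatᵀ)
    (Φhat : {j : Fin q // j ≠ 0} → ℝ)
    (hΦhat : Φhat = Adag *ᵥ (Sum.elim (fun _ => (0 : ℝ)) (fun _ => (1 : ℝ))))
    (B : ℝ)
    (hB : B = ((q : ℝ) / (1 - γ)) *
        (1 + (q : ℝ) *
            (⨆ col : {j : Fin q // j ≠ 0} ⊕ Unit,
              ∑ row : {j : Fin q // j ≠ 0}, |Adag row col|) / (1 - γ)))
    (HN : ℝ)
    (hHN : HN = ∑ j : {j : Fin q // j ≠ 0},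
        (∑ m ∈ Finset.range (N + 1),
          ∑ a : Fin q, h a ((gamma0 (EE 0))^[m] (E j.val)) * c j.val m) * Φhat j)
    (S : ℕ → ℝ)
    (hS : ∀ n : ℕ, S n = ∑ w : Fin n → Fin q,
        Real.negMulLog (τ ⬝ᵥ ((List.ofFn (fun i => EE (w i))).prod *ᵥ (fun _ => (1 : ℝ)))))
    (H : ℝ)
    (hH : Tendsto (fun n : ℕ => S n / n) atTop (nhds H)) :
    |H - HN| ≤ B * γ ^ (N + 1) := by
  classical
  have hepos : ∀ a, 0 < eps a := fun a => by
    by_cases ha : a = 0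
    · rw [ha, heps0]; exact one_pos
    · exact (heps a ha).1
  have hele : ∀ a, eps a ≤ 1 := fun a => by
    by_cases ha : a = 0
    · rw [ha, heps0]
    · exact (heps a ha).2.le
  have hM0 : ∀ b c, EE 0 b c = eps b * E b c := fun b c => by
    have e : EE 0 = ∑ a, eps a • F a := by
      rw [hEE0, ← Finset.add_sum_erase Finset.univ (fun a => eps a • F a) (Finset.mem_univ 0),
        heps0, one_smul]
    rw [e, Matrix.sum_apply]
    simp [hF]
  have hMa : ∀ a, a ≠ 0 → ∀ b c, EE a b c = if a = b then (1 - eps a) * E a c else 0 := by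
    intro a ha b c
    rw [hEEa a ha, Matrix.smul_apply, hF]
    simp
  have hMsum : ∑ a, EE a = E := by
    ext b c
    rw [Fintype.sum_eq_add_sum_subtype_ne EE 0, Matrix.add_apply, Matrix.sum_apply, hM0]
    have e : ∑ a : {j : Fin q // j ≠ 0}, EE a.val b c =
        ∑ a : {j : Fin q // j ≠ 0}, if a.val = b then (1 - eps a.val) * E a.val c else 0 :=
      Finset.sum_congr rfl fun a _ => hMa a.val a.2 b c
    rw [e]
    have e2 := Fintype.sum_eq_add_sum_subtype_ne
      (fun a => if a = b then (1 - eps a) * E a c else 0) 0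
    have e3 : ∑ a, (if a = b then (1 - eps a) * E a c else 0) = (1 - eps b) * E b c := by simp
    have e4 : (if (0 : Fin q) = b then (1 - eps 0) * E 0 c else 0) = 0 := by simp [heps0]
    simp only [e3, e4, zero_add] at e2
    rw [← e2]
    ring
  have hMnn : ∀ a i j, 0 ≤ EE a i j := fun a i j => by
    by_cases ha : a = 0
    · rw [ha, hM0]; exact mul_nonneg (hepos i).le (hE_pos i j).le
    · rw [hMa a ha]
      split_ifs
      · exact mul_nonneg (by linarith [hele a]) (hE_pos a j).le
      · exact le_rfl
  have hEnn : ∀ i j, 0 ≤ E i j := fun i j => (hE_pos i j).le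
  have hM1 : EE 0 *ᵥ (fun _ => (1 : ℝ)) = eps := by
    funext a
    simp only [mulVec, dotProduct, hM0, mul_one]
    rw [← Finset.mul_sum, hE_rows, mul_one]
  have hMi1 : ∀ a, a ≠ 0 → ∀ v : Fin q → ℝ,
      v ⬝ᵥ (EE a *ᵥ (fun _ => (1 : ℝ))) = v a * (1 - eps a) := by
    intro a ha v
    have : EE a *ᵥ (fun _ => (1 : ℝ)) = Pi.single a (1 - eps a) := by
      funext b
      simp only [mulVec, dotProduct, hMa a ha, mul_one]
      by_cases hab : a = b
      · subst hab
        simp [← Finset.mul_sum, hE_rows]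
      · simp [hab, Ne.symm hab]
    rw [this, dotProduct_single]
  have hMv : ∀ a : Fin q, a ≠ 0 → ∀ v : Fin q → ℝ, v ᵥ* EE a = ((1 - eps a) * v a) • E a := by
    intro a ha v
    funext i
    simp only [vecMul, dotProduct, hMa a ha, Pi.smul_apply, smul_eq_mul]
    simp
    ring
  have hG : ∀ j m, _ := fun j m => gamma0_iter E eps hE_pos hepos (EE 0) hM0 hM1 (E j)
    (hEnn j) (hE_rows j) m
  set G : Fin q → ℕ → Fin q → ℝ := fun j m => (gamma0 (EE 0))^[m] (E j) with hGdef
  have hc' : ∀ j m, c j m = ∏ i ∈ Finset.range m, G j i ⬝ᵥ eps := by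
    intro j m
    rw [hc, hM1]
    refine Finset.prod_bij' (fun i _ => m - i) (fun i _ => m - i) ?_ ?_ ?_ ?_ ?_
    · intro i hi; rw [Finset.mem_Icc] at hi; rw [Finset.mem_range]; omega
    · intro i hi; rw [Finset.mem_range] at hi; rw [Finset.mem_Icc]; omega
    · intro i hi; rw [Finset.mem_Icc] at hi; omega
    · intro i hi; rw [Finset.mem_range] at hi; omega
    · intro i hi; rfl
  have hGnn : ∀ j m i, 0 ≤ G j m i := fun j m => (hG j m).1
  have hGs : ∀ j m, ∑ i, G j m i = 1 := fun j m => (hG j m).2.1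
  have hGe : ∀ j m, 0 < G j m ⬝ᵥ eps := fun j m => (hG j m).2.2.1
  have hGc : ∀ j m, E j ᵥ* (EE 0) ^ m = c j m • G j m := fun j m => by
    rw [hc']; exact (hG j m).2.2.2
  have hGle1 : ∀ j m, G j m ⬝ᵥ eps ≤ 1 := fun j m => by
    rw [← hGs j m]
    exact Finset.sum_le_sum fun i _ => mul_le_of_le_one_right (hGnn j m i) (hele i)
  have hγle : ∀ (j : {j : Fin q // j ≠ 0}) m, G j.val m ⬝ᵥ eps ≤ γ := by
    intro j m
    have e : ∀ (j : {j : Fin q // j ≠ 0}) k,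
        ∑ a : Fin q, eps a * ((gamma0 (EE 0))^[k] (E j.val)) a = G j.val k ⬝ᵥ eps := by
      intro j k
      rw [dotProduct_comm]; rfl
    simp only [e] at hγ
    rw [hγ]
    refine le_trans ?_ (le_ciSup (f := fun j : {j : Fin q // j ≠ 0} => ⨆ k, G j.val k ⬝ᵥ eps)
      (Set.finite_range _).bddAbove j)
    exact le_ciSup (f := fun k => G j.val k ⬝ᵥ eps)
      ⟨1, by rintro _ ⟨k, rfl⟩; exact hGle1 _ _⟩ m
  have hj1 : (⟨1, by omega⟩ : Fin q) ≠ 0 := by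
    intro h
    have := congrArg Fin.val h
    simp at this
  have hγ0 : 0 ≤ γ := (hGe _ 0).le.trans (hγle ⟨_, hj1⟩ 0)
  have hc0 : ∀ j m, 0 ≤ c j m := fun j m => by
    rw [hc']; exact Finset.prod_nonneg fun i _ => (hGe j i).le
  have hc1 : ∀ (j : {j : Fin q // j ≠ 0}) m, c j.val m ≤ γ ^ m := fun j m => by
    rw [hc']
    calc _ ≤ ∏ i ∈ Finset.range m, γ :=
          Finset.prod_le_prod (fun i _ => (hGe _ i).le) fun i _ => hγle j i
      _ = γ ^ m := by simp
  set t : ℕ → ℝ := fun n => (τ ᵥ* (EE 0) ^ n) ⬝ᵥ (fun _ => (1 : ℝ)) with ht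
  have htt : Tendsto t atTop (nhds 0) := tail_tendsto hq E eps hE_pos hE_rows hepos hele
    (fun a ha => (heps a ha).2) (EE 0) hM0 hM1 τ hτ_nonneg
  have hdec := wsum_decomp EE E eps hMsum hMnn hEnn heps hMv τ hτ_nonneg hτ_stat
  set Φ : {j : Fin q // j ≠ 0} → ℝ := fun j => τ j.val * (1 - eps j.val) with hΦ
  have hΦ0 : ∀ j, 0 ≤ Φ j := fun j => mul_nonneg (hτ_nonneg _) (by linarith [hele j.val])
  have hΦ1 : ∑ j, Φ j ≤ 1 := by
    have e := Fintype.sum_eq_add_sum_subtype_ne τ 0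
    have : ∑ j, Φ j ≤ ∑ j : {j : Fin q // j ≠ 0}, τ j.val := Finset.sum_le_sum fun j _ =>
      mul_le_of_le_one_right (hτ_nonneg _) (by linarith [hepos j.val])
    linarith [hτ_nonneg 0]
  have hwlin : ∀ (u : Fin q → ℝ) n, wsum EE τ n (fun v => v ⬝ᵥ u) = τ ⬝ᵥ u := by
    intro u n
    have e := wsum_id EE E hMsum τ hτ_stat n
    unfold wsum at e ⊢
    rw [← sum_dotProduct, e]
  have hlin : ∀ (u : Fin q → ℝ) n, τ ⬝ᵥ u =
      ∑ m ∈ Finset.range n, ∑ j : {j : Fin q // j ≠ 0}, Φ j * (c j.val m * (G j.val m ⬝ᵥ u)) +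
        (τ ᵥ* (EE 0) ^ n) ⬝ᵥ u := by
    intro u n
    rw [← hwlin u n, hdec n (fun v => v ⬝ᵥ u) (fun s v _ _ => by
      simp only [smul_dotProduct, smul_eq_mul])]
    simp only [hGc, smul_dotProduct, smul_eq_mul, hΦ]
  have hone : ∀ n, 1 = ∑ m ∈ Finset.range n, ∑ j : {j : Fin q // j ≠ 0}, Φ j * c j.val m + t n := by
    intro n
    have e := hlin (fun _ => 1) n
    have e1 : τ ⬝ᵥ (fun _ => (1 : ℝ)) = 1 := by simpa [dotProduct] using hτ_sum
    have e2 : ∀ j m, G j m ⬝ᵥ (fun _ => (1 : ℝ)) = 1 := fun j m => by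
      simpa [dotProduct] using hGs j m
    simp only [e1, e2, mul_one] at e
    exact e
  set b : {j : Fin q // j ≠ 0} ⊕ Unit → ℝ :=
    Sum.elim (fun _ => (0 : ℝ)) (fun _ => (1 : ℝ)) with hbdef
  have hprob := fun j m => lfun_prob EE E hMsum hMnn hE_rows (G j m) (hGnn j m) (hGs j m)
  have hvnn := vecMul_pow_nonneg (EE 0) (hMnn 0) τ hτ_nonneg
  have ht0 : ∀ n, 0 ≤ t n := fun n => by
    simp only [ht, dotProduct, mul_one]
    exact Finset.sum_nonneg fun i _ => hvnn n i
  have hb : ∑ i, |(Ahat *ᵥ Φ - b) i| ≤ 2 * t (N+1) := by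
    rw [Fintype.sum_sum_type, Fintype.sum_unique (ι := Unit)]
    have hlast : |(Ahat *ᵥ Φ - b) (Sum.inr default)| = t (N+1) := by
      have e : (Ahat *ᵥ Φ - b) (Sum.inr default) = - t (N+1) := by
        have e0 := hone (N+1)
        have e1 : (Ahat *ᵥ Φ) (Sum.inr ()) =
            ∑ m ∈ Finset.range (N+1), ∑ j : {j : Fin q // j ≠ 0}, Φ j * c j.val m := by
          simp only [mulVec, dotProduct, hAhat_last]
          rw [Finset.sum_comm]
          refine Finset.sum_congr rfl fun j _ => ?_
          rw [← Finset.mul_sum, mul_comm]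
        change (Ahat *ᵥ Φ) (Sum.inr ()) - 1 = _
        rw [e1]
        linarith
      rw [e, abs_neg, abs_of_nonneg (ht0 _)]
    have hi : ∀ i : {j : Fin q // j ≠ 0}, |(Ahat *ᵥ Φ - b) (Sum.inl i)| ≤
        (τ ᵥ* (EE 0) ^ (N+1)) ⬝ᵥ (EE i.val *ᵥ (fun _ => (1 : ℝ))) := by
      intro i
      have hnn := dot_nonneg (EE i.val) (hMnn i.val) _ (hvnn (N+1))
      have eb : (Ahat *ᵥ Φ - b) (Sum.inl i) = (Ahat *ᵥ Φ) (Sum.inl i) := by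
        simp [hbdef]
      rw [eb]
      by_cases hq2 : q = 2
      · have : (Ahat *ᵥ Φ) (Sum.inl i) = 0 := by
          simp only [mulVec, dotProduct, hAhat_symbol, if_pos hq2, zero_mul, Finset.sum_const_zero]
        rw [this, abs_zero]
        exact hnn
      · have e0 := hlin (EE i.val *ᵥ (fun _ => (1 : ℝ))) (N+1)
        rw [hMi1 i.val i.2 τ] at e0
        have e1 : (Ahat *ᵥ Φ) (Sum.inl i) = - Φ i +
            ∑ m ∈ Finset.range (N+1), ∑ j : {j : Fin q // j ≠ 0},
              Φ j * (c j.val m * (G j.val m ⬝ᵥ (EE i.val *ᵥ (fun _ => (1 : ℝ))))) := by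
          simp only [mulVec, dotProduct, hAhat_symbol, if_neg hq2, add_mul, Finset.sum_add_distrib]
          congr 1
          · simp
          · rw [Finset.sum_comm]
            refine Finset.sum_congr rfl fun j _ => ?_
            rw [Finset.sum_mul]
            refine Finset.sum_congr rfl fun m _ => ?_
            ring
        have e2 : (Ahat *ᵥ Φ) (Sum.inl i) =
            - ((τ ᵥ* (EE 0) ^ (N+1)) ⬝ᵥ (EE i.val *ᵥ (fun _ => (1 : ℝ)))) := by
          rw [e1]
          change τ i.val * (1 - eps i.val) = _ at e0
          simp only [hΦ] at e0 ⊢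
          linarith
        rw [e2, abs_neg, abs_of_nonneg hnn]
    have hsumi := Finset.sum_le_sum (s := Finset.univ) fun i _ => hi i
    have e := sum_mulVec_one EE E hMsum hE_rows (τ ᵥ* (EE 0) ^ (N+1))
    rw [Fintype.sum_eq_add_sum_subtype_ne _ 0] at e
    have e0 := dot_nonneg (EE 0) (hMnn 0) _ (hvnn (N+1))
    have : (τ ᵥ* (EE 0) ^ (N+1)) ⬝ᵥ (fun _ => (1 : ℝ)) = t (N+1) := rfl
    linarith
  have hXA : Adag * Ahat = 1 := by
    rw [hAdag, Matrix.mul_assoc, Matrix.nonsing_inv_mul _ hAhat_unit]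
  have hSw : ∀ n, S n = wsum EE τ n (fun v => Real.negMulLog (v ⬝ᵥ (fun _ => (1 : ℝ)))) := by
    intro n
    rw [hS]
    simp only [wsum, Matrix.dotProduct_mulVec]
  have hSD : ∀ n, S n = ∑ i ∈ Finset.range n, wsum EE τ i (lfun EE) := by
    intro n
    induction n with
    | zero =>
      have e1 : τ ⬝ᵥ (fun _ => (1 : ℝ)) = 1 := by simpa [dotProduct] using hτ_sum
      rw [hSw, wsum_zero, e1]
      simp
    | succ n ih =>
      rw [Finset.sum_range_succ, ← ih, hSw, hSw, wsum_succ]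
      unfold wsum lfun
      rw [← Finset.sum_add_distrib]
      refine Finset.sum_congr rfl fun w _ => ?_
      simp only [Matrix.dotProduct_mulVec]
      ring
  rw [hB]
  refine numeric_bound (q : ℝ) γ (by exact_mod_cast hq) hγ0 hγ_lt_one Φ (fun j m => c j.val m)
    (fun j m => lfun EE (G j.val m)) t (fun n => lfun EE (τ ᵥ* (EE 0) ^ n))
    (fun n => wsum EE τ n (lfun EE)) S hΦ0 hΦ1 (fun j m => hc0 _ m) hc1
    (fun j m => (hprob j.val m).2.1) (fun j m => (hprob j.val m).2.2) hone htt ?_ ?_ hSD N Ahat Adag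
    hXA b hb Φhat hΦhat HN ?_ H hH
  · intro n
    rw [hdec n (lfun EE) (fun s v _ _ => lfun_hom EE E hMsum hE_rows s v)]
    simp only [hGc, lfun_hom EE E hMsum hE_rows, hΦ]
  · intro n
    exact lfun_bound EE E hMsum hMnn hE_rows _ (hvnn n)
  · rw [hHN]
    refine Finset.sum_congr rfl fun j _ => ?_
    congr 1
    refine Finset.sum_congr rfl fun m _ => ?_
    rw [(hprob j.val m).1, ← Finset.sum_mul, mul_comm]
    congr 1
    refine Finset.sum_congr rfl fun a _ => ?_
    rw [hh]
    rfl
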